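/- Let A and H be Hopf algebras over ℂ with bijective antipodes and π : A → H a surjective Hopf algebra map. Then the space of coinvariants B := A^{co(H)} = {a ∈ A : a₍₁₎ ⊗ π(a₍₂₎) = a ⊗ 1} satisfies B⁺A = AB⁺, where B⁺ := B ∩ ker(ε). -/

import Mathlib

/-!
STATEMENT 19: Let A and H be Hopf algebras over ℂ with bijective antipodes and
π : A → H a surjective Hopf algebra map.  Then the space of coinvariants
B := A^{co(H)} = {a ∈ A : a₍₁₎ ⊗ π(a₍₂₎) = a ⊗ 1} satisfies B⁺A = AB⁺,
where B⁺ := B ∩ ker(ε).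
-/

open TensorProduct

noncomputable section

namespace QHS

variable (A H : Type) [Ring A] [HopfAlgebra ℂ A] [Ring H] [HopfAlgebra ℂ H]

/-- The right `H`-coaction `Δ_{R,H} := (id ⊗ π) ∘ Δ` on `A` associated to a Hopf algebra
map `π : A → H`. -/
def coactR (π : A →ₐc[ℂ] H) : A →ₗ[ℂ] A ⊗[ℂ] H :=
  (LinearMap.lTensor A (π : A →ₗ[ℂ] H)) ∘ₗ Coalgebra.comul

/-- The space of coinvariants `A^{co(H)} = {a ∈ A : a₍₁₎ ⊗ π(a₍₂₎) = a ⊗ 1}`. -/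
def coinv (π : A →ₐc[ℂ] H) : Set A :=
  {a : A | coactR A H π a = a ⊗ₜ[ℂ] (1 : H)}

/-- The right ideal `B⁺A` generated by the augmentation ideal `B⁺ = B ∩ ker ε` of a
subset `B ⊆ A`. -/
def augLset (B : Set A) : Submodule ℂ A :=
  Submodule.span ℂ {x | ∃ b a : A, b ∈ B ∧ Coalgebra.counit (R := ℂ) b = 0 ∧ x = b * a}

/-- The left ideal `AB⁺` generated by the augmentation ideal `B⁺ = B ∩ ker ε` of a
subset `B ⊆ A`. -/
def augRset (B : Set A) : Submodule ℂ A :=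
  Submodule.span ℂ {x | ∃ b a : A, b ∈ B ∧ Coalgebra.counit (R := ℂ) b = 0 ∧ x = a * b}

end QHS

open QHS

namespace QHS

open LinearMap WithConv MulOpposite

section Convolution

variable {R C E P : Type*} [CommRing R] [AddCommGroup C] [Module R C] [Coalgebra R C]
  [Ring E] [Algebra R E] [Ring P] [Algebra R P]

/-- Postcomposition with an algebra map, as a monoid map between convolution algebras. -/
def convPostcomp (h : E →ₐ[R] P) : WithConv (C →ₗ[R] E) →* WithConv (C →ₗ[R] P) where
  toFun f := toConv (h.toLinearMap ∘ₗ f.ofConv)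
  map_one' := by ext c; simp
  map_mul' f g := congrArg toConv (algHom_comp_convMul_distrib h f g)

@[simp]
lemma convPostcomp_apply (h : E →ₐ[R] P) (f : WithConv (C →ₗ[R] E)) (c : C) :
    convPostcomp h f c = h (f c) := rfl

variable (R C) in
/-- The linear map `c ↦ ε(c) b`, as an element of the convolution algebra. -/
def convConst (b : E) : WithConv (C →ₗ[R] E) :=
  toConv ((Coalgebra.counit (R := R) (A := C)).smulRight b)

lemma convPostcomp_convConst (h : E →ₐ[R] P) (b : E) :
    convPostcomp h (convConst R C b) = convConst R C (h b) := by
  ext c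
  simp [convPostcomp, convConst]

lemma convMul_convConst_apply (f : WithConv (C →ₗ[R] E)) (b : E) (c : C) :
    (f * convConst R C b) c = f c * b := by
  conv_rhs => rw [← mul_one f]
  simp only [(Coalgebra.Repr.arbitrary R c).convMul_apply, Finset.sum_mul]
  simp [convConst, Algebra.algebraMap_eq_smul_one]

lemma convConst_convMul_apply (f : WithConv (C →ₗ[R] E)) (b : E) (c : C) :
    (convConst R C b * f) c = b * f c := by
  conv_rhs => rw [← one_mul f]
  simp only [(Coalgebra.Repr.arbitrary R c).convMul_apply, Finset.mul_sum]
  simp [convConst, Algebra.algebraMap_eq_smul_one]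

/-- If `r ∘ ι = (j ∘ ι) * p` for a convolution invertible `ι` with inverse `T`, and `b` lies in the
equalizer of `r` and `j` with `j b` commuting with the values of `p`, then so do the values of the
adjoint action `ι * b * T`. -/
lemma adjoint_mem_equalizer {ι T : WithConv (C →ₗ[R] E)} (hιT : ι * T = 1) (hTι : T * ι = 1)
    {j r : E →ₐ[R] P} {p : WithConv (C →ₗ[R] P)}
    (hp : convPostcomp r ι = convPostcomp j ι * p) {b : E} (hb : r b = j b)
    (hcomm : ∀ c, p c * j b = j b * p c) (c : C) :
    r ((ι * convConst R C b * T) c) = j ((ι * convConst R C b * T) c) := by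
  have hpT : p * convPostcomp r T = convPostcomp j T := by
    have h₁ : convPostcomp j ι * (p * convPostcomp r T) = 1 := by
      rw [← mul_assoc, ← hp, ← map_mul, hιT, map_one]
    have h₂ : convPostcomp j T * convPostcomp j ι = 1 := by rw [← map_mul, hTι, map_one]
    exact (left_inv_eq_right_inv h₂ h₁).symm
  have hpb : p * convConst R C (j b) = convConst R C (j b) * p := by
    ext c
    exact (convMul_convConst_apply _ _ _).trans
      ((hcomm c).trans (convConst_convMul_apply _ _ _).symm)
  have h : convPostcomp r (ι * convConst R C b * T) =
      convPostcomp j (ι * convConst R C b * T) := by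
    simp only [map_mul, convPostcomp_convConst, hb, hp]
    rw [mul_assoc (convPostcomp j ι), hpb, ← mul_assoc, mul_assoc _ p, hpT]
  exact congr($h c)

/-- In the setting of `adjoint_mem_equalizer`, the identity `ι * b = (ι * b * T) * ι` expresses
`ι c * b` through products `x * y` with `x` in the equalizer and in the kernel of `ε`. -/
lemma mul_mem_of_equalizer {ι T : WithConv (C →ₗ[R] E)} (hιT : ι * T = 1) (hTι : T * ι = 1)
    {j r : E →ₐ[R] P} {p : WithConv (C →ₗ[R] P)}
    (hp : convPostcomp r ι = convPostcomp j ι * p) {b : E} (hb : r b = j b)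
    (hcomm : ∀ c, p c * j b = j b * p c) {ε : E →ₐ[R] R} (hε : ε b = 0) {N : Submodule R E}
    (hN : ∀ x y, r x = j x → ε x = 0 → x * y ∈ N) (c : C) : ι c * b ∈ N := by
  have hfac : ι * convConst R C b = ι * convConst R C b * T * ι := by
    rw [mul_assoc _ T, hTι, mul_one]
  rw [← convMul_convConst_apply, hfac, (Coalgebra.Repr.arbitrary R c).convMul_apply]
  refine Submodule.sum_mem _ fun i _ ↦ hN _ _ (adjoint_mem_equalizer hιT hTι hp hb hcomm _) ?_
  have h0 : convConst R C (0 : R) = 0 := by ext; simp [convConst]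
  have h : convPostcomp ε (ι * convConst R C b * T) = 0 := by
    rw [map_mul, map_mul, convPostcomp_convConst, hε, h0, mul_zero, zero_mul]
  exact congr($h _)

end Convolution

section Opposite

variable {R A : Type*} [CommRing R] [Ring A] [HopfAlgebra R A]

/-- A right inverse of a bijective antipode is a convolution inverse of the identity
for the opposite multiplication. -/
lemma op_convMul_op_inv_antipode {T : A →ₗ[R] A}
    (hS : Function.Injective (HopfAlgebra.antipode R (A := A)))
    (hT : ∀ a, HopfAlgebra.antipode R (T a) = a) :
    toConv (opLinearEquiv R (M := A)).toLinearMap *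
        toConv ((opLinearEquiv R (M := A)).toLinearMap ∘ₗ T) = 1 ∧
      toConv ((opLinearEquiv R (M := A)).toLinearMap ∘ₗ T) *
        toConv (opLinearEquiv R (M := A)).toLinearMap = 1 := by
  let s : Aᵐᵒᵖ →ₐ[R] A := AlgHom.opComm (HopfAlgebra.antipodeAlgHomOp R A)
  have hs (a : A) : s (op a) = HopfAlgebra.antipode R a := rfl
  have hinj : Function.Injective (convPostcomp (C := A) s) := by
    intro f g h
    ext a
    exact unop_injective (hS congr($h a))
  have hι : convPostcomp s (toConv (opLinearEquiv R (M := A)).toLinearMap) =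
      toConv (HopfAlgebra.antipode R) := rfl
  have hTs : convPostcomp s (toConv ((opLinearEquiv R (M := A)).toLinearMap ∘ₗ T)) =
      toConv LinearMap.id := by
    ext a
    exact hT a
  constructor <;> apply hinj <;> rw [map_mul, map_one, hι, hTs] <;> simp

end Opposite

section Coaction

variable {A H : Type} [Ring A] [HopfAlgebra ℂ A] [Ring H] [HopfAlgebra ℂ H]

/-- The coaction `coactR` as an algebra map. -/
def coactRAlgHom (π : A →ₐc[ℂ] H) : A →ₐ[ℂ] A ⊗[ℂ] H :=
  (Algebra.TensorProduct.map (.id ℂ A) (π : A →ₐ[ℂ] H)).comp (Bialgebra.comulAlgHom ℂ A)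

lemma coactR_eq_sum (π : A →ₐc[ℂ] H) {a : A} {κ : Type*} (repr : Coalgebra.Repr ℂ a κ) :
    coactR A H π a = ∑ i ∈ repr.index, repr.left i ⊗ₜ[ℂ] π (repr.right i) := by
  simp [coactR, ← repr.eq]

lemma mul_mem_augLset (π : A →ₐc[ℂ] H) (a : A) {b : A} (hb : b ∈ coinv A H π)
    (hε : Coalgebra.counit (R := ℂ) b = 0) : a * b ∈ augLset A (coinv A H π) := by
  refine mul_mem_of_equalizer (C := A) (ι := toConv LinearMap.id)
    (T := toConv (HopfAlgebra.antipode ℂ)) (by simp) (by simp)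
    (j := Algebra.TensorProduct.includeLeft) (r := coactRAlgHom π)
    (p := toConv ((Algebra.TensorProduct.includeRight.comp (π : A →ₐ[ℂ] H)).toLinearMap))
    ?_ hb ?_ (ε := Bialgebra.counitAlgHom ℂ A) hε ?_ a
  · ext a
    refine (coactR_eq_sum π (Coalgebra.Repr.arbitrary ℂ a)).trans ?_
    refine Eq.trans ?_ ((Coalgebra.Repr.arbitrary ℂ a).convMul_apply _ _).symm
    simp
  · intro c
    simp
  · intro x y hx hx0
    exact Submodule.subset_span ⟨x, y, hx, hx0, rfl⟩

lemma mul_mem_augRset (hS : Function.Bijective (HopfAlgebra.antipode ℂ (A := A)))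
    (π : A →ₐc[ℂ] H) (a : A) {b : A} (hb : b ∈ coinv A H π)
    (hε : Coalgebra.counit (R := ℂ) b = 0) : b * a ∈ augRset A (coinv A H π) := by
  let T := (LinearEquiv.ofBijective _ hS).symm.toLinearMap
  obtain ⟨h₁, h₂⟩ := op_convMul_op_inv_antipode (T := T) hS.1
    (LinearEquiv.ofBijective _ hS).apply_symm_apply
  refine mul_mem_of_equalizer h₁ h₂
    (j := AlgHom.op Algebra.TensorProduct.includeLeft) (r := AlgHom.op (coactRAlgHom π))
    (p := toConv ((opLinearEquiv ℂ).toLinearMap ∘ₗ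
      (Algebra.TensorProduct.includeRight.comp (π : A →ₐ[ℂ] H)).toLinearMap))
    ?_ (b := op b) (congrArg op hb) ?_
    (ε := (Bialgebra.counitAlgHom ℂ A).fromOpposite fun _ _ ↦ Commute.all _ _) hε
    (N := (augRset A (coinv A H π)).comap (opLinearEquiv ℂ).symm.toLinearMap) ?_ a
  · ext a
    apply unop_injective
    refine (coactR_eq_sum π (Coalgebra.Repr.arbitrary ℂ a)).trans ?_
    refine Eq.trans ?_ (congrArg unop ((Coalgebra.Repr.arbitrary ℂ a).convMul_apply _ _)).symm
    simp
  · intro c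
    apply unop_injective
    simp
  · intro x y hx hx0
    exact Submodule.subset_span ⟨unop x, unop y, op_injective hx, hx0, rfl⟩

end Coaction

end QHS

/-- **Statement 19.** For `A`, `H` Hopf algebras over `ℂ` with bijective antipodes and
`π : A → H` a surjective Hopf algebra map, the space of coinvariants
`B := A^{co(H)}` satisfies `B⁺A = AB⁺`. -/
theorem coinvariants_aug_ideal_eq
    (A H : Type) [Ring A] [HopfAlgebra ℂ A] [Ring H] [HopfAlgebra ℂ H]
    (hSA : Function.Bijective (HopfAlgebra.antipode (R := ℂ) (A := A)))
    (hSH : Function.Bijective (HopfAlgebra.antipode (R := ℂ) (A := H)))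
    (π : A →ₐc[ℂ] H) (hπ : Function.Surjective π) :
    augLset A (coinv A H π) = augRset A (coinv A H π) := by
  apply le_antisymm <;> refine Submodule.span_le.2 ?_ <;> rintro _ ⟨b, a, hb, hε, rfl⟩
  · exact mul_mem_augRset hSA π a hb hε
  · exact mul_mem_augLset π a hb hε
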